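/- The real-linear map q ↦ a q + q b on the quaternions, viewed as a 4-dimensional real vector space, has characteristic polynomial whose complex roots are (a0 + b0) ± (|Im a| ± |Im b|) i, where a0, b0 are the real parts and |Im a| = sqrt(a1^2+a2^2+a3^2), |Im b| = sqrt(b1^2+b2^2+b3^2); equivalently, its characteristic polynomial equals ((X - (a0+b0))^2 + (|Im a| + |Im b|)^2)((X - (a0+b0))^2 + (|Im a| - |Im b|)^2). -/

import Mathlib

open Quaternion Polynomial

/-- The basis `1, i, j, k` of the real quaternions. -/
noncomputable def quaternionBasis : Module.Basis (Fin 4) ℝ (Quaternion ℝ) :=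
  QuaternionAlgebra.basisOneIJK (-1 : ℝ) 0 (-1)

theorem quaternionBasis_repr (q : Quaternion ℝ) :
    ⇑(quaternionBasis.repr q) = ![q.re, q.imI, q.imJ, q.imK] :=
  rfl

theorem quaternionBasis_components (i : Fin 4) :
    ![(quaternionBasis i).re, (quaternionBasis i).imI, (quaternionBasis i).imJ,
      (quaternionBasis i).imK] = Pi.single i 1 := by
  rw [← quaternionBasis_repr, Module.Basis.repr_self, Finsupp.single_eq_pi_single]

/-- The matrix of `q ↦ a q + q b` in the basis `1, i, j, k`. -/
theorem toMatrix_mulLeft_add_mulRight (a b : Quaternion ℝ) :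
    LinearMap.toMatrix quaternionBasis quaternionBasis
        (LinearMap.mulLeft ℝ a + LinearMap.mulRight ℝ b) =
      !![a.re + b.re, -a.imI - b.imI, -a.imJ - b.imJ, -a.imK - b.imK;
         a.imI + b.imI, a.re + b.re, -a.imK + b.imK, a.imJ - b.imJ;
         a.imJ + b.imJ, a.imK - b.imK, a.re + b.re, -a.imI + b.imI;
         a.imK + b.imK, -a.imJ + b.imJ, a.imI - b.imI, a.re + b.re] := by
  ext i j
  have hre : (quaternionBasis j).re = Pi.single (M := fun _ => ℝ) j 1 0 :=
    congrFun (quaternionBasis_components j) 0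
  have hI : (quaternionBasis j).imI = Pi.single (M := fun _ => ℝ) j 1 1 :=
    congrFun (quaternionBasis_components j) 1
  have hJ : (quaternionBasis j).imJ = Pi.single (M := fun _ => ℝ) j 1 2 :=
    congrFun (quaternionBasis_components j) 2
  have hK : (quaternionBasis j).imK = Pi.single (M := fun _ => ℝ) j 1 3 :=
    congrFun (quaternionBasis_components j) 3
  rw [LinearMap.toMatrix_apply, quaternionBasis_repr, LinearMap.add_apply,
    LinearMap.mulLeft_apply, LinearMap.mulRight_apply]
  simp only [Quaternion.re_add, Quaternion.imI_add, Quaternion.imJ_add, Quaternion.imK_add,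
    Quaternion.re_mul, Quaternion.imI_mul, Quaternion.imJ_mul, Quaternion.imK_mul, hre, hI, hJ, hK]
  fin_cases i <;> fin_cases j <;> simp [sub_eq_add_neg]

/-- The characteristic polynomial of the ℝ-linear map `q ↦ a q + q b` on the
quaternions equals
`((X - (a0+b0))² + (|Im a| + |Im b|)²) ((X - (a0+b0))² + (|Im a| - |Im b|)²)`,
i.e. its complex roots are `(a0 + b0) ± (|Im a| ± |Im b|) i`. -/
theorem charpoly_mulLeft_add_mulRight (a b : Quaternion ℝ) :
    (LinearMap.mulLeft ℝ a + LinearMap.mulRight ℝ b).charpoly =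
      ((X - C (a.re + b.re)) ^ 2 +
          C ((Real.sqrt (a.imI ^ 2 + a.imJ ^ 2 + a.imK ^ 2) +
              Real.sqrt (b.imI ^ 2 + b.imJ ^ 2 + b.imK ^ 2)) ^ 2)) *
        ((X - C (a.re + b.re)) ^ 2 +
          C ((Real.sqrt (a.imI ^ 2 + a.imJ ^ 2 + a.imK ^ 2) -
              Real.sqrt (b.imI ^ 2 + b.imJ ^ 2 + b.imK ^ 2)) ^ 2)) := by
  have hs := Real.sq_sqrt (show 0 ≤ a.imI ^ 2 + a.imJ ^ 2 + a.imK ^ 2 by positivity)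
  have ht := Real.sq_sqrt (show 0 ≤ b.imI ^ 2 + b.imJ ^ 2 + b.imK ^ 2 by positivity)
  set s := Real.sqrt (a.imI ^ 2 + a.imJ ^ 2 + a.imK ^ 2)
  set t := Real.sqrt (b.imI ^ 2 + b.imJ ^ 2 + b.imK ^ 2)
  refine Polynomial.funext fun x => ?_
  have hprod : ((x - (a.re + b.re)) ^ 2 + (s + t) ^ 2) * ((x - (a.re + b.re)) ^ 2 + (s - t) ^ 2) =
      (x - (a.re + b.re)) ^ 4 + 2 * (x - (a.re + b.re)) ^ 2 * (s ^ 2 + t ^ 2) +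
        (s ^ 2 - t ^ 2) ^ 2 := by ring
  rw [← LinearMap.charpoly_toMatrix _ quaternionBasis, toMatrix_mulLeft_add_mulRight,
    Matrix.eval_charpoly]
  simp only [eval_mul, eval_add, eval_pow, eval_sub, eval_X, eval_C]
  rw [hprod, hs, ht]
  simp [Matrix.det_succ_row_zero, Fin.sum_univ_succ, Fin.succAbove, Matrix.scalar_apply]
  ring
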